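/- Let m ≥ 1, n ≥ 0 be integers and x, y, ξ, η ∈ ℂ with x ≠ 0, Re(ξ/x) < 1, Im(η − ξy/x) > 0, and i(y + kx) ∉ [0,∞) for every k ∈ ℤ (in particular y/x ∉ ℤ, so tan(πy/x) ≠ 0). Then the function y' ↦ J_{m,n}(x,y',ξ,η) is complex-differentiable at y, and: if n ≥ 1 its derivative equals −i n · J_{m,n−1}(x,y,ξ,η) + 2πi · J_{m−1,n}(x,y,ξ,η); if n = 0 its derivative equals 2πi · J_{m−1,0}(x,y,ξ,η) + (−1)^m Li_m( e^{2πi(η − ξy/x)} ) / tan(πy/x). -/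

import Mathlib

open MeasureTheory Real Filter

/-- The polylogarithm `Li_p(w) = ∑_{j ≥ 1} w^j / j^p`, for integer index `p`. -/
noncomputable def Li (p : ℤ) (w : ℂ) : ℂ := ∑' j : ℕ, w ^ (j + 1) / ((j : ℂ) + 1) ^ p

/-- The integrand in the definition of `J_{m,n}(x,y,ξ,η)`. -/
noncomputable def Jfun (m n : ℕ) (x y ξ η : ℂ) (s : ℝ) : ℂ :=
  (s : ℂ) ^ n *
      Li m (Complex.exp (-(2 * (π : ℂ)) * (1 - ξ / x) * s +
        2 * (π : ℂ) * Complex.I * (η - ξ * y / x))) /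
    Complex.tanh ((π : ℂ) * ((s : ℂ) - Complex.I * y) / x)

/-- The function `J_{m,n}(x,y,ξ,η)`. -/
noncomputable def J (m n : ℕ) (x y ξ η : ℂ) : ℂ :=
  (-1 : ℂ) ^ (n + m + 1) * ∫ s in Set.Ioi (0 : ℝ), Jfun m n x y ξ η s

/-- The nonnegative real axis `[0,∞)` viewed as a subset of `ℂ`. -/
def nonnegRealAxis : Set ℂ := {z : ℂ | ∃ r : ℝ, 0 ≤ r ∧ z = r}

open scoped Topology

theorem norm_polylog_term_le (p j : ℕ) (E : ℂ) :
    ‖Complex.exp E ^ (j + 1) / ((j : ℂ) + 1) ^ (p : ℤ)‖ ≤ Real.exp E.re ^ (j + 1) := by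
  rw [norm_div, norm_pow, Complex.norm_exp, zpow_natCast, norm_pow]
  refine div_le_self (by positivity) (one_le_pow₀ ?_)
  have h : ‖(j : ℂ) + 1‖ = (j : ℝ) + 1 := by
    exact_mod_cast Complex.norm_natCast (j + 1)
  rw [h]
  linarith [(Nat.cast_nonneg j : (0 : ℝ) ≤ j)]

theorem hasSum_exp_pow_succ {t : ℝ} (ht : t < 0) :
    HasSum (fun j : ℕ => Real.exp t ^ (j + 1)) (Real.exp t * (1 - Real.exp t)⁻¹) := by
  simpa only [pow_succ'] using
    (hasSum_geometric_of_lt_one (Real.exp_pos t).le (Real.exp_lt_one_iff.2 ht)).mul_left (Real.exp t)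

theorem norm_Li_exp_le (p : ℕ) {E : ℂ} {t : ℝ} (ht : t < 0) (hE : E.re ≤ t) :
    ‖Li p (Complex.exp E)‖ ≤ Real.exp E.re * (1 - Real.exp t)⁻¹ := by
  refine (tsum_of_norm_bounded (hasSum_exp_pow_succ (hE.trans_lt ht))
    fun j => norm_polylog_term_le p j E).trans ?_
  have h1 : Real.exp t < 1 := Real.exp_lt_one_iff.2 ht
  gcongr

theorem isOpen_re_lt (t : ℝ) : IsOpen {E : ℂ | E.re < t} :=
  isOpen_lt Complex.continuous_re continuous_const

theorem continuousAt_Li_exp (p : ℕ) {E : ℂ} (hE : E.re < 0) :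
    ContinuousAt (fun E => Li p (Complex.exp E)) E := by
  obtain ⟨t, h1, h2⟩ := exists_between hE
  refine ContinuousOn.continuousAt (s := {E : ℂ | E.re < t}) ?_ ((isOpen_re_lt t).mem_nhds h1)
  refine continuousOn_tsum (fun j => by fun_prop) (hasSum_exp_pow_succ h2).summable ?_
  intro j F hF
  refine (norm_polylog_term_le p j F).trans ?_
  have : F.re ≤ t := le_of_lt hF
  gcongr

theorem hasDerivAt_Li_exp (p : ℕ) {E : ℂ} (hE : E.re < 0) :
    HasDerivAt (fun E => Li (p + 1 : ℕ) (Complex.exp E)) (Li p (Complex.exp E)) E := by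
  obtain ⟨t, h1, h2⟩ := exists_between hE
  refine hasDerivAt_tsum_of_isPreconnected
    (g := fun (j : ℕ) E => Complex.exp E ^ (j + 1) / ((j : ℂ) + 1) ^ ((p + 1 : ℕ) : ℤ))
    (g' := fun (j : ℕ) E => Complex.exp E ^ (j + 1) / ((j : ℂ) + 1) ^ (p : ℤ)) (t := {E : ℂ | E.re < t}) (y₀ := E)
    (hasSum_exp_pow_succ h2).summable (isOpen_re_lt t) (convex_halfSpace_re_lt t).isPreconnected
    ?_ ?_ h1 ?_ h1
  · intro j F _
    have hj : (j : ℂ) + 1 ≠ 0 := Nat.cast_add_one_ne_zero j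
    have := (((Complex.hasDerivAt_exp F).pow (j + 1)).div_const
      (((j : ℂ) + 1) ^ ((p + 1 : ℕ) : ℤ)))
    refine this.congr_deriv ?_
    simp only [zpow_natCast]
    push_cast
    field_simp
    ring
  · intro j F hF
    refine (norm_polylog_term_le p j F).trans ?_
    have : F.re ≤ t := le_of_lt hF
    gcongr
  · exact .of_norm_bounded (hasSum_exp_pow_succ hE).summable fun j => norm_polylog_term_le _ j E

theorem hasDerivAt_inv_tanh {z : ℂ} (hz : Complex.sinh z ≠ 0) :
    HasDerivAt (fun z => (Complex.tanh z)⁻¹) (1 - (Complex.tanh z)⁻¹ ^ 2) z := by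
  have h : (fun z => (Complex.tanh z)⁻¹) = fun z => Complex.cosh z / Complex.sinh z := by
    funext z; rw [Complex.tanh_eq_sinh_div_cosh, inv_div]
  rw [h, Complex.tanh_eq_sinh_div_cosh, inv_div]
  refine ((Complex.hasDerivAt_cosh z).div (Complex.hasDerivAt_sinh z) hz).congr_deriv ?_
  field_simp

theorem norm_cosh_le (z : ℂ) : ‖Complex.cosh z‖ ≤ Real.cosh z.re := by
  have h : Complex.cosh z = (Complex.exp z + Complex.exp (-z)) / 2 := rfl
  rw [h, Real.cosh_eq, norm_div, Complex.norm_two]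
  gcongr
  refine (norm_add_le _ _).trans_eq ?_
  simp [Complex.norm_exp]

theorem abs_sinh_le_norm (z : ℂ) : |Real.sinh z.re| ≤ ‖Complex.sinh z‖ := by
  have h : Complex.sinh z = (Complex.exp z - Complex.exp (-z)) / 2 := rfl
  rw [h, Real.sinh_eq, norm_div, Complex.norm_two, abs_div, abs_two]
  gcongr
  simpa [Complex.norm_exp] using abs_norm_sub_norm_le (Complex.exp z) (Complex.exp (-z))

theorem norm_inv_tanh_le {δ : ℝ} (hδ : 0 < δ) {z : ℂ} (hz : δ ≤ |z.re|) :
    Complex.sinh z ≠ 0 ∧ ‖(Complex.tanh z)⁻¹‖ ≤ 1 + δ⁻¹ := by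
  have hsinh : δ ≤ Real.sinh |z.re| :=
    hz.trans (Real.self_le_sinh_iff.2 (abs_nonneg _))
  have hs : Real.sinh |z.re| ≤ ‖Complex.sinh z‖ := by
    rw [← Real.abs_sinh]; exact abs_sinh_le_norm z
  have hpos : 0 < ‖Complex.sinh z‖ := hδ.trans_le (hsinh.trans hs)
  refine ⟨norm_pos_iff.1 hpos, ?_⟩
  rw [Complex.tanh_eq_sinh_div_cosh, inv_div, norm_div, div_le_iff₀ hpos]
  have hc : Real.cosh |z.re| ≤ Real.sinh |z.re| + 1 := by
    have h1 := Real.cosh_sub_sinh |z.re|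
    have h2 : Real.exp (-|z.re|) ≤ 1 := Real.exp_le_one_iff.2 (by simp)
    linarith
  calc ‖Complex.cosh z‖ ≤ Real.cosh |z.re| := by rw [Real.cosh_abs]; exact norm_cosh_le z
    _ ≤ ‖Complex.sinh z‖ + δ⁻¹ * δ := by rw [inv_mul_cancel₀ hδ.ne']; linarith
    _ ≤ ‖Complex.sinh z‖ + δ⁻¹ * ‖Complex.sinh z‖ := by gcongr; exact hsinh.trans hs
    _ = (1 + δ⁻¹) * ‖Complex.sinh z‖ := by ring

theorem sinh_ne_zero_of_ray {x y : ℂ} (hx : x ≠ 0)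
    (hray : ∀ k : ℤ, Complex.I * (y + (k : ℂ) * x) ∉ nonnegRealAxis) {s : ℝ} (hs : 0 ≤ s) :
    Complex.sinh ((π : ℂ) * ((s : ℂ) - Complex.I * y) / x) ≠ 0 := by
  intro h
  have h' : Complex.sin ((π : ℂ) * ((s : ℂ) - Complex.I * y) / x * Complex.I) = 0 := by
    rw [Complex.sin_mul_I, h, zero_mul]
  obtain ⟨k, hk⟩ := Complex.sin_eq_zero_iff.1 h'
  have hpi : (π : ℂ) ≠ 0 := Complex.ofReal_ne_zero.2 Real.pi_ne_zero
  refine hray (-k) ⟨s, hs, ?_⟩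
  field_simp at hk
  push_cast
  linear_combination (Complex.I) * hk - (s - Complex.I * y) * Complex.I_sq

theorem im_div_ne_zero_of_ray {x y : ℂ} (hx : x ≠ 0)
    (hray : ∀ k : ℤ, Complex.I * (y + (k : ℂ) * x) ∉ nonnegRealAxis)
    (hre : x.re = 0) : (y / x).im ≠ 0 := by
  intro him
  obtain ⟨t, ht⟩ : ∃ t : ℝ, y = t * x := by
    refine ⟨(y / x).re, ?_⟩
    have : (((y / x).re : ℝ) : ℂ) = y / x := by apply Complex.ext <;> simp [him]
    rw [this]; field_simp
  have hxI : x = (x.im : ℂ) * Complex.I := by apply Complex.ext <;> simp [hre]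
  obtain ⟨k, hk⟩ : ∃ k : ℤ, 0 ≤ -((t + k) * x.im) := by
    rcases le_total 0 x.im with h | h
    · refine ⟨-⌈t⌉, ?_⟩
      have := Int.le_ceil t
      push_cast
      nlinarith
    · refine ⟨-⌊t⌋, ?_⟩
      have := Int.floor_le t
      push_cast
      nlinarith
  refine hray k ⟨_, hk, ?_⟩
  rw [ht]
  push_cast
  linear_combination Complex.I * (t + k) * hxI + (t + k) * x.im * Complex.I_sq

theorem eventually_norm_inv_tanh_le {x y : ℂ} (hx : x ≠ 0)
    (hray : ∀ k : ℤ, Complex.I * (y + (k : ℂ) * x) ∉ nonnegRealAxis) :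
    ∃ C : ℝ, ∀ᶠ y' in 𝓝 y, ∀ s : ℝ, 0 ≤ s →
      Complex.sinh ((π : ℂ) * ((s : ℂ) - Complex.I * y') / x) ≠ 0 ∧
      ‖(Complex.tanh ((π : ℂ) * ((s : ℂ) - Complex.I * y') / x))⁻¹‖ ≤ C := by
  have hre : ∀ (s : ℝ) (y' : ℂ), ((π : ℂ) * ((s : ℂ) - Complex.I * y') / x).re =
      s * (π * (x⁻¹).re) + π * (y' / x).im := by
    intro s y'
    have : (π : ℂ) * ((s : ℂ) - Complex.I * y') / x =
        ((s * π : ℝ) : ℂ) * x⁻¹ - (π : ℂ) * (Complex.I * (y' / x)) := by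
      push_cast; field_simp
    rw [this, Complex.sub_re, Complex.re_ofReal_mul, Complex.re_ofReal_mul, Complex.I_mul_re]
    ring
  have hcont : Continuous fun y' : ℂ => π * (y' / x).im :=
    continuous_const.mul (Complex.continuous_im.comp (continuous_id.div_const x))
  by_cases hκ : (x⁻¹).re = 0
  · have hxre : x.re = 0 := by
      rw [Complex.inv_re, div_eq_zero_iff] at hκ
      exact hκ.resolve_right (by simpa using hx)
    have hu : 0 < |π * (y / x).im| :=
      abs_pos.2 (mul_ne_zero Real.pi_ne_zero (im_div_ne_zero_of_ray hx hray hxre))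
    refine ⟨1 + (|π * (y / x).im| / 2)⁻¹, ?_⟩
    filter_upwards [hcont.abs.continuousAt.eventually_const_lt (half_lt_self hu)] with y' hy' s _
    refine norm_inv_tanh_le (half_pos hu) ?_
    rw [hre, hκ]
    simpa using hy'.le
  · set B := |π * (y / x).im| + 1
    set κ := π * (x⁻¹).re
    have hκ0 : 0 < |κ| := abs_pos.2 (mul_ne_zero Real.pi_ne_zero hκ)
    have hz : Continuous fun q : ℂ × ℝ => (π : ℂ) * ((q.2 : ℂ) - Complex.I * q.1) / x := by
      fun_prop
    have hat : ∀ s ∈ Set.Icc 0 ((B + 1) / |κ|), ContinuousAt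
        (fun q : ℂ × ℝ => (Complex.tanh ((π : ℂ) * ((q.2 : ℂ) - Complex.I * q.1) / x))⁻¹)
        (y, s) := by
      intro s hs
      have h := (hasDerivAt_inv_tanh (sinh_ne_zero_of_ray hx hray hs.1)).continuousAt
      exact h.comp_of_eq (hz.continuousAt (x := (y, s))) rfl
    obtain ⟨C, hC⟩ := isCompact_Icc.exists_bound_of_continuousOn (s := Set.Icc 0 ((B + 1) / |κ|))
      (f := fun s : ℝ => (Complex.tanh ((π : ℂ) * ((s : ℂ) - Complex.I * y) / x))⁻¹)
      (fun s hs => ((hat s hs).comp (f := fun s : ℝ => (y, s))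
        (by fun_prop)).continuousWithinAt)
    have hnear := isCompact_Icc.eventually_forall_of_forall_eventually (x₀ := y)
      (K := Set.Icc 0 ((B + 1) / |κ|))
      (P := fun y' s => Complex.sinh ((π : ℂ) * ((s : ℂ) - Complex.I * y') / x) ≠ 0 ∧
        ‖(Complex.tanh ((π : ℂ) * ((s : ℂ) - Complex.I * y') / x))⁻¹‖ < C + 1) (by
      intro s hs
      refine Eventually.and ?_ ?_
      · exact (Complex.continuous_sinh.comp hz).continuousAt.eventually_ne
          (sinh_ne_zero_of_ray hx hray hs.1)
      · exact (hat s hs).norm.eventually_lt_const ((hC s hs).trans_lt (lt_add_one C)))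
    refine ⟨max (C + 1) (1 + 1⁻¹), ?_⟩
    filter_upwards [hnear, hcont.abs.continuousAt.eventually_lt_const (lt_add_one _)]
      with y' hy' hb s hs
    by_cases hs' : s ≤ (B + 1) / |κ|
    · exact ⟨(hy' s ⟨hs, hs'⟩).1, (hy' s ⟨hs, hs'⟩).2.le.trans (le_max_left _ _)⟩
    · have h1 : 1 ≤ |((π : ℂ) * ((s : ℂ) - Complex.I * y') / x).re| := by
        rw [hre]
        have h2 : B + 1 < s * |κ| := (div_lt_iff₀ hκ0).1 (not_le.1 hs')
        have h3 := abs_sub_abs_le_abs_add (s * κ) (π * (y' / x).im)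
        rw [abs_mul, abs_of_nonneg hs] at h3
        linarith
      exact (norm_inv_tanh_le one_pos h1).imp_right fun h => h.trans (le_max_right _ _)

/-- The exponent of the argument of the polylogarithm in `Jfun`. -/
noncomputable def Jphase (x y ξ η : ℂ) (s : ℝ) : ℂ :=
  -(2 * (π : ℂ)) * (1 - ξ / x) * s + 2 * (π : ℂ) * Complex.I * (η - ξ * y / x)

/-- The argument of the hyperbolic tangent in `Jfun`. -/
noncomputable def Jarg (x y : ℂ) (s : ℝ) : ℂ := (π : ℂ) * ((s : ℂ) - Complex.I * y) / x

theorem Jfun_eq (m n : ℕ) (x y ξ η : ℂ) (s : ℝ) :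
    Jfun m n x y ξ η s =
      (s : ℂ) ^ n * Li m (Complex.exp (Jphase x y ξ η s)) * (Complex.tanh (Jarg x y s))⁻¹ :=
  div_eq_mul_inv _ _

/-- The derivative of `Jfun (k + 1) n x y ξ η s` with respect to `y`. -/
noncomputable def JfunDy (k n : ℕ) (x y ξ η : ℂ) (s : ℝ) : ℂ :=
  (s : ℂ) ^ n *
    (Li k (Complex.exp (Jphase x y ξ η s)) * (-(2 * (π : ℂ) * Complex.I * ξ / x)) *
        (Complex.tanh (Jarg x y s))⁻¹ +
      Li (k + 1 : ℕ) (Complex.exp (Jphase x y ξ η s)) *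
        ((1 - (Complex.tanh (Jarg x y s))⁻¹ ^ 2) * (-((π : ℂ) * Complex.I / x))))

theorem hasDerivAt_Jfun_left (k n : ℕ) {x y ξ η : ℂ} {s : ℝ} (hE : (Jphase x y ξ η s).re < 0)
    (hz : Complex.sinh (Jarg x y s) ≠ 0) :
    HasDerivAt (fun y' => Jfun (k + 1) n x y' ξ η s) (JfunDy k n x y ξ η s) y := by
  have h1 : HasDerivAt (fun y' => Jphase x y' ξ η s) (-(2 * (π : ℂ) * Complex.I * ξ / x)) y := by
    refine ((((((hasDerivAt_id y).const_mul ξ).div_const x).const_sub η).const_mul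
      (2 * (π : ℂ) * Complex.I)).const_add (-(2 * (π : ℂ)) * (1 - ξ / x) * s)).congr_deriv ?_
    ring
  have h2 : HasDerivAt (fun y' => Jarg x y' s) (-((π : ℂ) * Complex.I / x)) y := by
    refine (((((hasDerivAt_id y).const_mul Complex.I).const_sub (s : ℂ)).const_mul
      (π : ℂ)).div_const x).congr_deriv ?_
    ring
  have h3 := (hasDerivAt_Li_exp k hE).comp y h1
  have h4 := (hasDerivAt_inv_tanh hz).comp y h2
  have h5 := ((h3.mul h4).const_mul ((s : ℂ) ^ n))
  refine (h5.congr_deriv ?_).congr_of_eventuallyEq (.of_forall fun y' => ?_)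
  · rfl
  · exact (Jfun_eq _ _ _ _ _ _ _).trans (mul_assoc _ _ _)

theorem hasDerivAt_Jfun_right (k n : ℕ) {x y ξ η : ℂ} {s : ℝ}
    (hE : (Jphase x y ξ η s).re < 0) (hz : Complex.sinh (Jarg x y s) ≠ 0) :
    HasDerivAt (fun s : ℝ => Jfun (k + 1) n x y ξ η s)
      (n * Jfun (k + 1) (n - 1) x y ξ η s +
        Complex.I * (JfunDy k n x y ξ η s + 2 * (π : ℂ) * Complex.I * Jfun k n x y ξ η s)) s := by
  have h0 : HasDerivAt (fun s : ℝ => (s : ℂ)) 1 s := Complex.ofRealCLM.hasDerivAt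
  have h1 : HasDerivAt (fun s : ℝ => Jphase x y ξ η s) (-(2 * (π : ℂ)) * (1 - ξ / x)) s := by
    refine ((h0.const_mul (-(2 * (π : ℂ)) * (1 - ξ / x))).add_const
      (2 * (π : ℂ) * Complex.I * (η - ξ * y / x))).congr_deriv ?_
    ring
  have h2 : HasDerivAt (fun s : ℝ => Jarg x y s) ((π : ℂ) / x) s := by
    refine (((h0.sub_const (Complex.I * y)).const_mul (π : ℂ)).div_const x).congr_deriv ?_
    ring
  have h3 := (hasDerivAt_Li_exp k hE).comp s h1
  have h4 := (hasDerivAt_inv_tanh hz).comp s h2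
  have h5 := (((hasDerivAt_pow n (s : ℂ)).comp s h0).mul h3).mul h4
  refine (h5.congr_deriv ?_).congr_of_eventuallyEq (.of_forall fun s' => ?_)
  · simp only [Jfun_eq, JfunDy, Function.comp_apply, Pi.mul_apply]
    ring_nf
    simp only [Complex.I_sq]
    ring
  · exact Jfun_eq _ _ _ _ _ _ _

/-- Uniform control over `s ≥ 0` of the two factors of the integrand `Jfun`. -/
def JRegular (x ξ η : ℂ) (α β C : ℝ) (y : ℂ) : Prop :=
  ∀ s : ℝ, 0 ≤ s → (Jphase x y ξ η s).re ≤ -α * s - β ∧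
    Complex.sinh (Jarg x y s) ≠ 0 ∧ ‖(Complex.tanh (Jarg x y s))⁻¹‖ ≤ C

theorem exists_eventually_JRegular {x y ξ η : ℂ} (hx : x ≠ 0)
    (hξ : (ξ / x).re < 1) (hη : 0 < (η - ξ * y / x).im)
    (hray : ∀ k : ℤ, Complex.I * (y + (k : ℂ) * x) ∉ nonnegRealAxis) :
    ∃ α β C : ℝ, 0 < α ∧ 0 < β ∧ ∀ᶠ y' in 𝓝 y, JRegular x ξ η α β C y' := by
  obtain ⟨C, hC⟩ := eventually_norm_inv_tanh_le hx hray
  refine ⟨2 * π * (1 - (ξ / x).re), 2 * π * ((η - ξ * y / x).im / 2), C,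
    mul_pos Real.two_pi_pos (sub_pos.2 hξ), mul_pos Real.two_pi_pos (half_pos hη), ?_⟩
  have hcont : Continuous fun y' : ℂ => (η - ξ * y' / x).im := by fun_prop
  filter_upwards [hC, hcont.continuousAt.eventually_const_lt (half_lt_self hη)] with y' h1 h2 s hs
  refine ⟨?_, h1 s hs⟩
  have hre : (Jphase x y' ξ η s).re =
      -(2 * π * (1 - (ξ / x).re)) * s - 2 * π * (η - ξ * y' / x).im := by
    have : Jphase x y' ξ η s = ((-(2 * π) * s : ℝ) : ℂ) * (1 - ξ / x) +
        ((2 * π : ℝ) : ℂ) * (Complex.I * (η - ξ * y' / x)) := by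
      rw [Jphase]; push_cast; ring
    rw [this, Complex.add_re, Complex.re_ofReal_mul, Complex.re_ofReal_mul, Complex.I_mul_re,
      Complex.sub_re, Complex.one_re]
    ring
  rw [hre]
  have := Real.two_pi_pos
  gcongr

section Regular

variable {x y ξ η : ℂ} {α β C : ℝ}

theorem JRegular.re_neg (h : JRegular x ξ η α β C y) (hα : 0 < α) (hβ : 0 < β) {s : ℝ}
    (hs : 0 ≤ s) : (Jphase x y ξ η s).re < 0 := by
  have := (h s hs).1
  nlinarith [mul_nonneg hα.le hs]

theorem JRegular.norm_Li_le (h : JRegular x ξ η α β C y) (hα : 0 < α) (hβ : 0 < β) (p : ℕ)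
    {s : ℝ} (hs : 0 ≤ s) :
    ‖Li p (Complex.exp (Jphase x y ξ η s))‖ ≤ Real.exp (-α * s) * (1 - Real.exp (-β))⁻¹ := by
  have h1 := (h s hs).1
  have h2 : 0 < 1 - Real.exp (-β) := sub_pos.2 (Real.exp_lt_one_iff.2 (neg_lt_zero.2 hβ))
  refine (norm_Li_exp_le p (neg_lt_zero.2 hβ) ?_).trans ?_
  · nlinarith [mul_nonneg hα.le hs]
  · gcongr
    linarith

theorem JRegular.norm_Jfun_le (h : JRegular x ξ η α β C y) (hα : 0 < α) (hβ : 0 < β) (p n : ℕ)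
    {s : ℝ} (hs : 0 ≤ s) :
    ‖Jfun p n x y ξ η s‖ ≤ s ^ n * Real.exp (-α * s) * ((1 - Real.exp (-β))⁻¹ * C) := by
  have h1 := h.norm_Li_le hα hβ p hs
  have h2 := (h s hs).2.2
  have hK : 0 ≤ Real.exp (-α * s) * (1 - Real.exp (-β))⁻¹ := (norm_nonneg _).trans h1
  rw [Jfun_eq, norm_mul, norm_mul, norm_pow, Complex.norm_of_nonneg hs]
  calc _ ≤ s ^ n * (Real.exp (-α * s) * (1 - Real.exp (-β))⁻¹) * C := by gcongr
    _ = _ := by ring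

theorem JRegular.norm_JfunDy_le (h : JRegular x ξ η α β C y) (hα : 0 < α) (hβ : 0 < β) (k n : ℕ)
    {s : ℝ} (hs : 0 ≤ s) :
    ‖JfunDy k n x y ξ η s‖ ≤ s ^ n * Real.exp (-α * s) * ((1 - Real.exp (-β))⁻¹ *
      (‖-(2 * (π : ℂ) * Complex.I * ξ / x)‖ * C + (1 + C ^ 2) * ‖-((π : ℂ) * Complex.I / x)‖)) := by
  have h1 := h.norm_Li_le hα hβ k hs
  have h1' := h.norm_Li_le hα hβ (k + 1) hs
  have h2 := (h s hs).2.2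
  have h3 : ‖1 - (Complex.tanh (Jarg x y s))⁻¹ ^ 2‖ ≤ 1 + C ^ 2 := by
    refine (norm_sub_le _ _).trans ?_
    rw [norm_one, norm_pow]
    gcongr
  have hK : 0 ≤ Real.exp (-α * s) * (1 - Real.exp (-β))⁻¹ := (norm_nonneg _).trans h1
  rw [JfunDy, norm_mul, norm_pow, Complex.norm_of_nonneg hs, mul_assoc (s ^ n)]
  gcongr
  refine (norm_add_le _ _).trans ?_
  rw [norm_mul, norm_mul, norm_mul, norm_mul (1 - _)]
  calc _ ≤ Real.exp (-α * s) * (1 - Real.exp (-β))⁻¹ *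
          ‖-(2 * (π : ℂ) * Complex.I * ξ / x)‖ * C +
        Real.exp (-α * s) * (1 - Real.exp (-β))⁻¹ *
          ((1 + C ^ 2) * ‖-((π : ℂ) * Complex.I / x)‖) := by gcongr
    _ = _ := by ring

theorem JRegular.continuousAt_Li (h : JRegular x ξ η α β C y) (hα : 0 < α) (hβ : 0 < β) (p : ℕ)
    {s : ℝ} (hs : 0 ≤ s) :
    ContinuousAt (fun s => Li p (Complex.exp (Jphase x y ξ η s))) s := by
  have hc : Continuous fun s => Jphase x y ξ η s := by unfold Jphase; fun_prop
  exact (continuousAt_Li_exp p (h.re_neg hα hβ hs)).comp hc.continuousAt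

theorem JRegular.continuousAt_inv_tanh (h : JRegular x ξ η α β C y) {s : ℝ} (hs : 0 ≤ s) :
    ContinuousAt (fun s => (Complex.tanh (Jarg x y s))⁻¹) s := by
  have hc : Continuous fun s => Jarg x y s := by unfold Jarg; fun_prop
  exact (hasDerivAt_inv_tanh (h s hs).2.1).continuousAt.comp hc.continuousAt

theorem JRegular.continuousAt_Jfun (h : JRegular x ξ η α β C y) (hα : 0 < α) (hβ : 0 < β)
    (p n : ℕ) {s : ℝ} (hs : 0 ≤ s) : ContinuousAt (Jfun p n x y ξ η) s := by
  have h1 := h.continuousAt_Li hα hβ p hs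
  have h2 := h.continuousAt_inv_tanh hs
  simp only [funext (Jfun_eq p n x y ξ η)]
  fun_prop

theorem JRegular.continuousAt_JfunDy (h : JRegular x ξ η α β C y) (hα : 0 < α) (hβ : 0 < β)
    (k n : ℕ) {s : ℝ} (hs : 0 ≤ s) : ContinuousAt (JfunDy k n x y ξ η) s := by
  have h1 := h.continuousAt_Li hα hβ k hs
  have h1' := h.continuousAt_Li hα hβ (k + 1) hs
  have h2 := h.continuousAt_inv_tanh hs
  unfold JfunDy
  fun_prop

theorem aestronglyMeasurable_of_continuousAt {f : ℝ → ℂ} (hf : ∀ s, 0 ≤ s → ContinuousAt f s) :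
    AEStronglyMeasurable f (volume.restrict (Set.Ioi (0 : ℝ))) :=
  ContinuousOn.aestronglyMeasurable
    (fun s hs => (hf s (le_of_lt hs)).continuousWithinAt) measurableSet_Ioi

theorem integrableOn_pow_mul_exp_neg_mul (hα : 0 < α) (n : ℕ) :
    IntegrableOn (fun s : ℝ => s ^ n * Real.exp (-α * s)) (Set.Ioi 0) := by
  simpa using integrableOn_rpow_mul_exp_neg_mul_rpow (s := (n : ℝ)) (p := 1) (b := α)
    (by linarith [(Nat.cast_nonneg n : (0 : ℝ) ≤ n)]) one_pos hα

theorem JRegular.integrableOn_Jfun (h : JRegular x ξ η α β C y) (hα : 0 < α) (hβ : 0 < β)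
    (p n : ℕ) : IntegrableOn (Jfun p n x y ξ η) (Set.Ioi 0) := by
  refine Integrable.mono' ((integrableOn_pow_mul_exp_neg_mul hα n).mul_const
      ((1 - Real.exp (-β))⁻¹ * C))
    (aestronglyMeasurable_of_continuousAt fun s hs => h.continuousAt_Jfun hα hβ p n hs) ?_
  filter_upwards [ae_restrict_mem measurableSet_Ioi] with s hs
  exact h.norm_Jfun_le hα hβ p n (le_of_lt hs)

theorem JRegular.tendsto_Jfun (h : JRegular x ξ η α β C y) (hα : 0 < α) (hβ : 0 < β)
    (p n : ℕ) : Tendsto (Jfun p n x y ξ η) atTop (𝓝 0) := by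
  have h0 : Tendsto (fun s : ℝ => s ^ n * Real.exp (-α * s) * ((1 - Real.exp (-β))⁻¹ * C))
      atTop (𝓝 0) := by
    simpa using (tendsto_rpow_mul_exp_neg_mul_atTop_nhds_zero n α hα).mul_const
      ((1 - Real.exp (-β))⁻¹ * C)
  refine squeeze_zero_norm' ?_ h0
  filter_upwards [eventually_ge_atTop 0] with s hs
  exact h.norm_Jfun_le hα hβ p n hs

end Regular

theorem hasDerivAt_integral_Jfun {x y ξ η : ℂ} {α β C : ℝ} (hα : 0 < α) (hβ : 0 < β)
    (h : ∀ᶠ y' in 𝓝 y, JRegular x ξ η α β C y') (k n : ℕ) :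
    HasDerivAt (fun y' => ∫ s in Set.Ioi (0 : ℝ), Jfun (k + 1) n x y' ξ η s)
      (Complex.I * n * (∫ s in Set.Ioi (0 : ℝ), Jfun (k + 1) (n - 1) x y ξ η s) +
        Complex.I * Jfun (k + 1) n x y ξ η 0 -
        2 * (π : ℂ) * Complex.I * ∫ s in Set.Ioi (0 : ℝ), Jfun k n x y ξ η s) y := by
  have hy := h.self_of_nhds
  obtain ⟨hint, hder⟩ := hasDerivAt_integral_of_dominated_loc_of_deriv_le
    (μ := volume.restrict (Set.Ioi (0 : ℝ))) (F := fun y' s => Jfun (k + 1) n x y' ξ η s)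
    (F' := fun y' s => JfunDy k n x y' ξ η s) h
    (h.mono fun y' hy' => aestronglyMeasurable_of_continuousAt fun s hs =>
      hy'.continuousAt_Jfun hα hβ (k + 1) n hs)
    (hy.integrableOn_Jfun hα hβ (k + 1) n)
    (aestronglyMeasurable_of_continuousAt fun s hs => hy.continuousAt_JfunDy hα hβ k n hs)
    (by
      filter_upwards [ae_restrict_mem measurableSet_Ioi] with s hs y' hy'
      exact JRegular.norm_JfunDy_le hy' hα hβ k n (le_of_lt hs))
    ((integrableOn_pow_mul_exp_neg_mul hα n).mul_const _)
    (by
      filter_upwards [ae_restrict_mem measurableSet_Ioi] with s hs y' hy'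
      exact hasDerivAt_Jfun_left k n (JRegular.re_neg hy' hα hβ (le_of_lt hs))
        (hy' s (le_of_lt hs)).2.1)
  refine hder.congr_deriv ?_
  have i1 : IntegrableOn (fun s => (n : ℂ) * Jfun (k + 1) (n - 1) x y ξ η s) (Set.Ioi 0) :=
    (hy.integrableOn_Jfun hα hβ (k + 1) (n - 1)).const_mul _
  have i2 : IntegrableOn (fun s => 2 * (π : ℂ) * Complex.I * Jfun k n x y ξ η s) (Set.Ioi 0) :=
    (hy.integrableOn_Jfun hα hβ k n).const_mul _
  have i3 : IntegrableOn (fun s => Complex.I * (JfunDy k n x y ξ η s +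
      2 * (π : ℂ) * Complex.I * Jfun k n x y ξ η s)) (Set.Ioi 0) := (hint.add i2).const_mul _
  have key := integral_Ioi_of_hasDerivAt_of_tendsto'
    (fun s hs => hasDerivAt_Jfun_right k n (hy.re_neg hα hβ hs) (hy s hs).2.1)
    (i1.add i3) (hy.tendsto_Jfun hα hβ (k + 1) n)
  rw [integral_add i1 i3, integral_const_mul, integral_const_mul, integral_add hint i2,
    integral_const_mul] at key
  linear_combination (-Complex.I) * key + (∫ s in Set.Ioi (0 : ℝ), JfunDy k n x y ξ η s) *
    Complex.I_sq + 2 * (π : ℂ) * Complex.I * (∫ s in Set.Ioi (0 : ℝ), Jfun k n x y ξ η s) *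
    Complex.I_sq

theorem stmt4 (m n : ℕ) (hm : 1 ≤ m) (x y ξ η : ℂ) (hx : x ≠ 0)
    (hξ : (ξ / x).re < 1) (hη : 0 < (η - ξ * y / x).im)
    (hray : ∀ k : ℤ, Complex.I * (y + (k : ℂ) * x) ∉ nonnegRealAxis) :
    (1 ≤ n → HasDerivAt (fun y' : ℂ => J m n x y' ξ η)
      (-Complex.I * (n : ℂ) * J m (n - 1) x y ξ η +
        2 * (π : ℂ) * Complex.I * J (m - 1) n x y ξ η) y) ∧
    (n = 0 → HasDerivAt (fun y' : ℂ => J m 0 x y' ξ η)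
      (2 * (π : ℂ) * Complex.I * J (m - 1) 0 x y ξ η +
        (-1 : ℂ) ^ m * Li m (Complex.exp (2 * (π : ℂ) * Complex.I * (η - ξ * y / x))) /
          Complex.tan ((π : ℂ) * y / x)) y) := by
  obtain ⟨α, β, C, hα, hβ, h⟩ := exists_eventually_JRegular hx hξ hη hray
  obtain ⟨k, rfl⟩ : ∃ k, m = k + 1 := ⟨m - 1, by omega⟩
  rw [Nat.add_sub_cancel]
  have key := fun n => (hasDerivAt_integral_Jfun hα hβ h k n).const_mul
    ((-1 : ℂ) ^ (n + (k + 1) + 1))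
  constructor
  · intro hn
    obtain ⟨l, rfl⟩ : ∃ l, n = l + 1 := ⟨n - 1, by omega⟩
    refine (key (l + 1)).congr_deriv ?_
    have h0 : Jfun (k + 1) (l + 1) x y ξ η 0 = 0 := by simp [Jfun]
    rw [h0, J, J, Nat.add_sub_cancel]
    ring
  · rintro -
    refine (key 0).congr_deriv ?_
    have h0 : Complex.I * Jfun (k + 1) 0 x y ξ η 0 =
        -(Li (k + 1 : ℕ) (Complex.exp (2 * (π : ℂ) * Complex.I * (η - ξ * y / x))) /
          Complex.tan ((π : ℂ) * y / x)) := by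
      have h1 : (π : ℂ) * (((0 : ℝ) : ℂ) - Complex.I * y) / x =
          -((π : ℂ) * y / x * Complex.I) := by
        push_cast; ring
      rw [Jfun, h1, Complex.tanh_neg, Complex.tanh_mul_I]
      simp only [Complex.ofReal_zero, mul_zero, zero_add, pow_zero, one_mul, div_eq_mul_inv,
        inv_neg, mul_inv, Complex.inv_I]
      linear_combination Li (k + 1 : ℕ) (Complex.exp (2 * (π : ℂ) * Complex.I *
        (η - ξ * y * x⁻¹))) * (Complex.tan ((π : ℂ) * y * x⁻¹))⁻¹ * Complex.I_sq
    rw [h0, J]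
    push_cast
    ring
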